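/- For every r > 2 there is a constant C depending only on r such that the following holds for all ε ∈ (0,1], t ∈ [0,ε], τ > 0. Let w̄ = (w̄_ξ)_{ξ∈ℝ} be a family of continuously differentiable functions w̄_ξ : [0,∞) → ℂ with w̄_ξ(0) = 0, and A = (A_ξ)_{ξ∈ℝ} ⊂ ℂ, for which all norms below are finite and all integrals converge absolutely. Define ℒ_ξ(y) = i∫_ℝ ( w̄_η(y)(ξ−η)A_{ξ−η}θ_{ξ−η}(y) + A_ηθ_η(y)(ξ−η)w̄_{ξ−η}(y) − η I_y[w̄_η] A_{ξ−η} ∂_yθ_{ξ−η}(y) ) dη and T_ℒ = ∫_ℝ∫_0^∞ ℒ_ξ(y) conj(w̄_ξ(y)) ρ(y)² e^{2τ|ξ|} ⟨ξ⟩^{2r} dy dξ. Then |T_ℒ| ≤ C ( ‖|∂ₓ|^{1/2} w̄‖_{τ,r} ‖w̄‖_{τ,r} ‖|∂ₓ|^{1/2} A‖~_{τ,r} + ( ‖w̄‖²_{τ,r} + ‖|∂ₓ|^{1/2} w̄‖²_{τ,r} ) ‖A‖~_{τ,r} ). -/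

import Mathlib

open MeasureTheory Set Filter

noncomputable section

/-- Gaussian weight `ρ(y) = exp(y²/(8(1+t/ε)))`. -/
def rho (ε t y : ℝ) : ℝ := Real.exp (y ^ 2 / (8 * (1 + t / ε)))

/-- Japanese bracket `⟨ξ⟩ = √(1+ξ²)`. -/
def brak (ξ : ℝ) : ℝ := Real.sqrt (1 + ξ ^ 2)

/-- Combined weight `ρ(y)² e^{2τ|ξ|} ⟨ξ⟩^{2s}` in the squared analytic norms. -/
def wgt (ε t τ s ξ y : ℝ) : ℝ :=
  (rho ε t y) ^ 2 * Real.exp (2 * τ * |ξ|) * brak ξ ^ (2 * s)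

/-- Weight `e^{2τ|ξ|} ⟨ξ⟩^{2s}` for the squared analytic norms of boundary data. -/
def aWgt (τ s ξ : ℝ) : ℝ := Real.exp (2 * τ * |ξ|) * brak ξ ^ (2 * s)

/-- Analytic norm `‖w‖_{τ,s}` (with Fourier multiplier `m`):
`(∫_ℝ ∫_0^∞ m(ξ) ρ(y)² |w_ξ(y)|² e^{2τ|ξ|} ⟨ξ⟩^{2s} dy dξ)^{1/2}`. -/
def wNorm (ε t τ s : ℝ) (m : ℝ → ℝ) (w : ℝ → ℝ → ℂ) : ℝ :=
  Real.sqrt (∫ ξ : ℝ, ∫ y in Ioi (0 : ℝ), m ξ * ‖w ξ y‖ ^ 2 * wgt ε t τ s ξ y)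

/-- Analytic norm `‖A‖~_{τ,s}` (with Fourier multiplier `m`):
`(∫_ℝ m(ξ) |A_ξ|² e^{2τ|ξ|} ⟨ξ⟩^{2s} dξ)^{1/2}`. -/
def aNorm (τ s : ℝ) (m : ℝ → ℝ) (A : ℝ → ℂ) : ℝ :=
  Real.sqrt (∫ ξ : ℝ, m ξ * ‖A ξ‖ ^ 2 * aWgt τ s ξ)

/-- Finiteness of the squared norm `‖·‖_{τ,s}` with multiplier `m`. -/
def wFinite (ε t τ s : ℝ) (m : ℝ → ℝ) (w : ℝ → ℝ → ℂ) : Prop :=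
  Integrable (fun p : ℝ × ℝ => m p.1 * ‖w p.1 p.2‖ ^ 2 * wgt ε t τ s p.1 p.2)
    ((volume : Measure ℝ).prod ((volume : Measure ℝ).restrict (Ioi 0)))

/-- Finiteness of the squared norm `‖·‖~_{τ,s}` with multiplier `m`. -/
def aFinite (τ s : ℝ) (m : ℝ → ℝ) (A : ℝ → ℂ) : Prop :=
  Integrable (fun ξ : ℝ => m ξ * ‖A ξ‖ ^ 2 * aWgt τ s ξ) (volume : Measure ℝ)

/-- Lift function `θ_ξ(y) = 1 − exp(−y²⟨ξ⟩²/(2(1+t/ε)))`. -/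
def theta (ε t ξ y : ℝ) : ℝ :=
  1 - Real.exp (-(y ^ 2 * (1 + ξ ^ 2)) / (2 * (1 + t / ε)))

/-- `I_y[h] = ∫_0^y h`. -/
def Iy (h : ℝ → ℂ) (y : ℝ) : ℂ := ∫ y' in (0 : ℝ)..y, h y'

/-- The linear term `ℒ_ξ(w̄,A)(y)`. -/
def Lcal (ε t : ℝ) (w : ℝ → ℝ → ℂ) (A : ℝ → ℂ) (ξ y : ℝ) : ℂ :=
  Complex.I * ∫ η : ℝ,
    (w η y * ((ξ - η : ℝ) : ℂ) * A (ξ - η) * ((theta ε t (ξ - η) y : ℝ) : ℂ)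
      + A η * ((theta ε t η y : ℝ) : ℂ) * ((ξ - η : ℝ) : ℂ) * w (ξ - η) y
      - (η : ℂ) * Iy (w η) y * A (ξ - η) * ((deriv (theta ε t (ξ - η)) y : ℝ) : ℂ))

def L2N {α : Type*} [MeasurableSpace α] (ν : Measure α) (f : α → ENNReal) : ENNReal :=
  (∫⁻ x, f x ^ (2:ℝ) ∂ν) ^ (1 / 2 : ℝ)

lemma holder2 {α : Type*} [MeasurableSpace α] (ν : Measure α) {f g : α → ENNReal}
    (hf : AEMeasurable f ν) (hg : AEMeasurable g ν) :
    ∫⁻ x, f x * g x ∂ν ≤ L2N ν f * L2N ν g := by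
  have := ENNReal.lintegral_mul_le_Lp_mul_Lq ν Real.HolderConjugate.two_two hf hg
  simpa [L2N] using this

lemma tri_zeta {g p q s : ℝ → ENNReal} (hg : Measurable g) (hp : Measurable p)
    (hq : Measurable q) (hs : Measurable s) :
    ∫⁻ z : ℝ × ℝ, g (z.1 - z.2) * p (z.1 - z.2) * q z.2 * s z.1 ∂(volume.prod volume)
      ≤ L2N volume g * L2N volume p * L2N volume q * L2N volume s := by
  rw [lintegral_prod _ (by fun_prop)]
  have h1 : ∀ x : ℝ, ∫⁻ y, g (x - y) * p (x - y) * q y * s x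
      = ∫⁻ y, g y * p y * (q (x - y) * s x) := by
    intro x
    rw [← lintegral_sub_left_eq_self (fun y => g y * p y * (q (x - y) * s x)) x]
    refine lintegral_congr fun y => ?_
    simp only [sub_sub_cancel]
    ring
  simp only [h1]
  rw [lintegral_lintegral_swap (by simp only [Function.uncurry_def]; fun_prop)]
  calc ∫⁻ y, ∫⁻ x, g y * p y * (q (x - y) * s x)
      ≤ ∫⁻ y, g y * p y * (L2N volume q * L2N volume s) := by
        refine lintegral_mono fun y => ?_
        dsimp only
        rw [lintegral_const_mul _ (by fun_prop)]
        gcongr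
        refine (holder2 volume (f := fun x => q (x - y)) (by fun_prop) (by fun_prop)).trans ?_
        gcongr
        unfold L2N
        rw [lintegral_sub_right_eq_self (fun x => q x ^ (2:ℝ)) y]
    _ = (∫⁻ y, g y * p y) * (L2N volume q * L2N volume s) := by
        rw [lintegral_mul_const _ (by fun_prop)]
    _ ≤ (L2N volume g * L2N volume p) * (L2N volume q * L2N volume s) := by
        gcongr
        exact holder2 volume (by fun_prop) (by fun_prop)
    _ = _ := by ring

lemma tri_eta {g p q s : ℝ → ENNReal} (hg : Measurable g) (hp : Measurable p)
    (hq : Measurable q) (hs : Measurable s) :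
    ∫⁻ z : ℝ × ℝ, g z.2 * q z.2 * p (z.1 - z.2) * s z.1 ∂(volume.prod volume)
      ≤ L2N volume g * L2N volume q * L2N volume p * L2N volume s := by
  refine le_trans (le_of_eq ?_) (tri_zeta hg hq hp hs)
  rw [lintegral_prod _ (by fun_prop), lintegral_prod _ (by fun_prop)]
  refine lintegral_congr fun x => ?_
  dsimp only
  rw [← lintegral_sub_left_eq_self (fun y => g (x-y) * q (x-y) * p y * s x) x]
  simp only [sub_sub_cancel]

lemma one_le_brak (x : ℝ) : 1 ≤ brak x := by
  unfold brak
  rw [Real.one_le_sqrt]; nlinarith [sq_nonneg x]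

lemma brak_pos (x : ℝ) : 0 < brak x := lt_of_lt_of_le one_pos (one_le_brak x)

lemma abs_le_brak (x : ℝ) : |x| ≤ brak x := by
  unfold brak
  apply Real.le_sqrt_of_sq_le
  rw [sq_abs]; linarith

lemma brak_add_le (x y : ℝ) : brak (x + y) ≤ brak x + brak y := by
  have hx := abs_le_brak x
  have hy := abs_le_brak y
  have h1 : x * y ≤ brak x * brak y :=
    (le_abs_self _).trans (by rw [abs_mul]; gcongr; exact (brak_pos x).le)
  have hx2 : brak x ^ 2 = 1 + x ^ 2 := Real.sq_sqrt (by positivity)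
  have hy2 : brak y ^ 2 = 1 + y ^ 2 := Real.sq_sqrt (by positivity)
  have := brak_pos x
  have := brak_pos y
  unfold brak at *
  rw [Real.sqrt_le_left (by linarith)]
  nlinarith

lemma brak_rpow_add_le {r : ℝ} (hr : 0 ≤ r) (x y : ℝ) :
    brak (x + y) ^ r ≤ 2 ^ r * (brak x ^ r + brak y ^ r) := by
  have hx := brak_pos x
  have hy := brak_pos y
  have h := brak_add_le x y
  have h0 := brak_pos (x + y)
  rcases le_total (brak x) (brak y) with hl | hl
  · calc brak (x + y) ^ r ≤ (2 * brak y) ^ r := by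
          apply Real.rpow_le_rpow h0.le (by linarith) hr
      _ = 2 ^ r * brak y ^ r := Real.mul_rpow (by norm_num) hy.le
      _ ≤ _ := by gcongr; linarith [Real.rpow_nonneg hx.le r]
  · calc brak (x + y) ^ r ≤ (2 * brak x) ^ r := by
          apply Real.rpow_le_rpow h0.le (by linarith) hr
      _ = 2 ^ r * brak x ^ r := Real.mul_rpow (by norm_num) hx.le
      _ ≤ _ := by gcongr; linarith [Real.rpow_nonneg hy.le r]

lemma sqrt_abs_add (x y : ℝ) : Real.sqrt |x + y| ≤ Real.sqrt |x| + Real.sqrt |y| := by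
  refine (Real.sqrt_le_sqrt (abs_add_le x y)).trans ?_
  rw [Real.sqrt_le_left (by positivity)]
  nlinarith [Real.sq_sqrt (abs_nonneg x), Real.sq_sqrt (abs_nonneg y),
    Real.sqrt_nonneg |x|, Real.sqrt_nonneg |y|, mul_nonneg (Real.sqrt_nonneg |x|) (Real.sqrt_nonneg |y|)]

def gk (r x : ℝ) : ℝ := brak x ^ (1 - r)

lemma kernel_aux {r : ℝ} (hr : 0 ≤ r) (z e : ℝ) :
    brak (z + e) ^ r * (|z| + 2 * |e|) ≤ 2 * 2 ^ r * (brak z ^ r * brak e ^ r) *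
      (gk r z + gk r e + √|e| * √|z + e| * gk r z + √|e| * √|z| * gk r z
        + √|z| * √|z + e| * gk r e + √|z| * √|e| * gk r e) := by
  have hz := brak_pos z
  have he := brak_pos e
  have h1 : brak z ^ r * gk r z = brak z := by
    unfold gk; rw [← Real.rpow_add hz]; simp
  have h2 : brak e ^ r * gk r e = brak e := by
    unfold gk; rw [← Real.rpow_add he]; simp
  have h := brak_rpow_add_le hr z e
  have hzr := Real.rpow_pos_of_pos hz r
  have her := Real.rpow_pos_of_pos he r
  have s1 : √|e| ≤ √|z + e| + √|z| := by
    have := sqrt_abs_add (z + e) (-z); simpa using this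
  have s2 : √|z| ≤ √|z + e| + √|e| := by
    have := sqrt_abs_add (z + e) (-e); simpa using this
  have q1 : √|e| * √|e| = |e| := Real.mul_self_sqrt (abs_nonneg e)
  have q2 : √|z| * √|z| = |z| := Real.mul_self_sqrt (abs_nonneg z)
  have n0 := Real.sqrt_nonneg |z + e|
  have n1 := Real.sqrt_nonneg |e|
  have n2 := Real.sqrt_nonneg |z|
  have oz := one_le_brak z
  have oe := one_le_brak e
  have az := abs_le_brak z
  have ae := abs_le_brak e
  have k1 : |z| + 2 * |e| ≤ 2 * (brak z * (1 + √|e| * √|z + e| + √|e| * √|z|)) := by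
    have : |e| ≤ √|e| * √|z + e| + √|e| * √|z| := by nlinarith
    have hn := abs_nonneg z
    nlinarith [mul_nonneg n1 n0, mul_nonneg n1 n2]
  have k2 : |z| + 2 * |e| ≤ 2 * (brak e * (1 + √|z| * √|z + e| + √|z| * √|e|)) := by
    have : |z| ≤ √|z| * √|z + e| + √|z| * √|e| := by nlinarith
    nlinarith [mul_nonneg n2 n0, mul_nonneg n2 n1]
  calc brak (z + e) ^ r * (|z| + 2 * |e|)
      ≤ 2 ^ r * (brak z ^ r + brak e ^ r) * (|z| + 2 * |e|) := by gcongr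
    _ = 2 ^ r * (brak e ^ r * (|z| + 2 * |e|) + brak z ^ r * (|z| + 2 * |e|)) := by ring
    _ ≤ 2 ^ r * (brak e ^ r * (2 * (brak z * (1 + √|e| * √|z + e| + √|e| * √|z|)))
        + brak z ^ r * (2 * (brak e * (1 + √|z| * √|z + e| + √|z| * √|e|)))) := by gcongr
    _ = 2 ^ r * (brak e ^ r * (2 * ((brak z ^ r * gk r z) * (1 + √|e| * √|z + e| + √|e| * √|z|)))
        + brak z ^ r * (2 * ((brak e ^ r * gk r e) * (1 + √|z| * √|z + e| + √|z| * √|e|)))) := by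
        rw [h1, h2]
    _ = _ := by ring

/-- half weight -/
def hw (τ r x : ℝ) : ℝ := Real.exp (τ * |x|) * brak x ^ r

lemma hw_nonneg (τ r x : ℝ) : 0 ≤ hw τ r x :=
  mul_nonneg (Real.exp_pos _).le (Real.rpow_nonneg (brak_pos x).le _)

lemma hw_sq (τ r x : ℝ) : hw τ r x ^ 2 = aWgt τ r x := by
  unfold hw aWgt
  rw [mul_pow, ← Real.exp_nat_mul, ← Real.rpow_natCast (brak x ^ r), ← Real.rpow_mul (brak_pos x).le]
  congr 2 <;> push_cast <;> ring

lemma kernel_bd {r τ : ℝ} (hr : 0 ≤ r) (hτ : 0 < τ) (z e : ℝ) :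
    hw τ r (z + e) * (|z| + 2 * |e|) ≤ 2 * 2 ^ r * (hw τ r z * hw τ r e) *
      (gk r z + gk r e + √|e| * √|z + e| * gk r z + √|e| * √|z| * gk r z
        + √|z| * √|z + e| * gk r e + √|z| * √|e| * gk r e) := by
  have h := kernel_aux hr z e
  have he : Real.exp (τ * |z + e|) ≤ Real.exp (τ * |z|) * Real.exp (τ * |e|) := by
    rw [← Real.exp_add, Real.exp_le_exp, ← mul_add]
    exact mul_le_mul_of_nonneg_left (abs_add_le z e) hτ.le
  have hp : 0 ≤ brak (z + e) ^ r * (|z| + 2 * |e|) :=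
    mul_nonneg (Real.rpow_nonneg (brak_pos _).le _) (by positivity)
  have := mul_le_mul he h hp (by positivity)
  unfold hw
  refine le_trans (le_of_eq ?_) (this.trans (le_of_eq ?_)) <;> ring

lemma brak_cont : Continuous brak := by unfold brak; fun_prop

lemma hw_meas (τ r : ℝ) : Measurable (hw τ r) := by
  have := brak_cont.measurable
  unfold hw
  fun_prop

lemma gk_meas (r : ℝ) : Measurable (gk r) := by
  have := brak_cont.measurable
  unfold gk
  fun_prop

lemma gk_L2 {r : ℝ} (hr : 2 < r) : L2N volume (fun x => ENNReal.ofReal (gk r x)) ≠ ⊤ := by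
  unfold L2N
  refine ENNReal.rpow_ne_top_of_nonneg (by norm_num) ?_
  have h := integrable_rpow_neg_one_add_norm_sq (E := ℝ) (μ := volume) (r := 2 * r - 2)
    (by simp; linarith)
  refine ne_of_lt (lt_of_eq_of_lt ?_ h.lintegral_lt_top)
  refine lintegral_congr fun x => ?_
  dsimp only
  rw [ENNReal.ofReal_rpow_of_nonneg (by unfold gk; exact Real.rpow_nonneg (brak_pos x).le _) (by norm_num)]
  unfold gk brak
  rw [Real.sqrt_eq_rpow, ← Real.rpow_mul (by positivity), ← Real.rpow_mul (by positivity)]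
  congr 1
  simp only [Real.norm_eq_abs, sq_abs]
  congr 1
  ring

def dth (ε t ξ y : ℝ) : ℝ :=
  y * ((1 + ξ ^ 2) / (1 + t / ε)) * Real.exp (-(y ^ 2 * (1 + ξ ^ 2)) / (2 * (1 + t / ε)))

lemma deriv_theta {ε t : ℝ} (hs : 0 < 1 + t / ε) (ξ y : ℝ) :
    deriv (theta ε t ξ) y = dth ε t ξ y := by
  have h1 : HasDerivAt (fun y : ℝ => -(y ^ 2 * (1 + ξ ^ 2)) / (2 * (1 + t / ε)))
      (-(2 * y * (1 + ξ ^ 2)) / (2 * (1 + t / ε))) y := by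
    have := ((((hasDerivAt_pow 2 y).mul_const (1 + ξ ^ 2)).neg).div_const (2 * (1 + t / ε)))
    simpa using this
  have h2 := (h1.exp).const_sub 1
  have : deriv (theta ε t ξ) y = _ := h2.deriv
  rw [this]
  unfold dth
  generalize Real.exp (-(y ^ 2 * (1 + ξ ^ 2)) / (2 * (1 + t / ε))) = E
  generalize 1 + t / ε = σ at *
  field_simp
  try ring

lemma theta_abs {ε t : ℝ} (hs : 0 < 1 + t / ε) (ξ y : ℝ) : ‖((theta ε t ξ y : ℝ) : ℂ)‖ₑ ≤ 1 := by
  have h : ‖((theta ε t ξ y : ℝ) : ℂ)‖ ≤ 1 := by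
    rw [Complex.norm_real, Real.norm_eq_abs, abs_le]
    unfold theta
    have h1 := Real.exp_pos (-(y ^ 2 * (1 + ξ ^ 2)) / (2 * (1 + t / ε)))
    have h2 : Real.exp (-(y ^ 2 * (1 + ξ ^ 2)) / (2 * (1 + t / ε))) ≤ 1 := by
      rw [Real.exp_le_one_iff]
      apply div_nonpos_of_nonpos_of_nonneg
      · have : 0 ≤ y ^ 2 * (1 + ξ ^ 2) := by positivity
        linarith
      · positivity
    constructor <;> linarith
  rw [← ofReal_norm]
  simpa using ENNReal.ofReal_le_ofReal h

lemma one_le_rho {ε t : ℝ} (hs : 0 < 1 + t / ε) (y : ℝ) : 1 ≤ rho ε t y := by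
  unfold rho
  rw [Real.one_le_exp_iff]
  positivity

lemma rho_meas (ε t : ℝ) : Measurable (rho ε t) := by
  unfold rho; fun_prop

lemma dth_L2 {ε t : ℝ} (hs : 0 < 1 + t / ε) (ξ : ℝ) :
    L2N (volume.restrict (Ioi 0)) (fun y => ENNReal.ofReal (√y * dth ε t ξ y) *
      ENNReal.ofReal (rho ε t y)) ≤ 1 := by
  unfold L2N
  refine ENNReal.rpow_le_one ?_ (by norm_num)
  set σ := 1 + t / ε with hσ
  set k := (1 + ξ ^ 2) / σ with hk
  have hkpos : 0 < k := by positivity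
  have hb : 0 < 3 / 4 * k := by positivity
  have hi := integrableOn_rpow_mul_exp_neg_mul_sq hb (s := 3) (by norm_num)
  have hv := integral_rpow_mul_exp_neg_mul_rpow (p := 2) (q := 3) (b := 3 / 4 * k)
    (by norm_num) (by norm_num) hb
  have hv2 : ∫ x in Ioi (0:ℝ), x ^ (3:ℝ) * Real.exp (-(3 / 4 * k) * x ^ 2) = 8 / 9 / k ^ 2 := by
    norm_num at hv
    norm_num
    rw [hv]
    field_simp
    norm_num
  calc ∫⁻ y in Ioi (0:ℝ), (ENNReal.ofReal (√y * dth ε t ξ y) * ENNReal.ofReal (rho ε t y)) ^ (2:ℝ)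
      ≤ ∫⁻ y in Ioi (0:ℝ), ENNReal.ofReal (k ^ 2 * (y ^ (3:ℝ) * Real.exp (-(3 / 4 * k) * y ^ 2))) := by
        refine setLIntegral_mono' measurableSet_Ioi fun y hy => ?_
        have hy0 : 0 < y := hy
        have hd : 0 ≤ √y * dth ε t ξ y := by
          unfold dth; positivity
        rw [← ENNReal.ofReal_mul hd, ENNReal.ofReal_rpow_of_nonneg (mul_nonneg hd (by unfold rho; positivity)) (by norm_num)]
        apply ENNReal.ofReal_le_ofReal
        unfold dth rho
        rw [← hσ, ← hk]
        rw [show (3:ℝ) = ((3:ℕ):ℝ) by norm_num, show (2:ℝ) = ((2:ℕ):ℝ) by norm_num, Real.rpow_natCast, Real.rpow_natCast]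
        rw [mul_pow, mul_pow, mul_pow, Real.sq_sqrt hy0.le, ← Real.exp_nat_mul, ← Real.exp_nat_mul]
        push_cast
        have : Real.exp (2 * (-(y ^ 2 * (1 + ξ ^ 2)) / (2 * σ))) * Real.exp (2 * (y ^ 2 / (8 * σ)))
            ≤ Real.exp (-(3 / 4 * k) * y ^ 2) := by
          rw [← Real.exp_add, Real.exp_le_exp, hk]
          have : -(3 / 4 * ((1 + ξ ^ 2) / σ)) * y ^ 2 - (2 * (-(y ^ 2 * (1 + ξ ^ 2)) / (2 * σ)) + 2 * (y ^ 2 / (8 * σ))) = ξ ^ 2 * y ^ 2 / (4 * σ) := by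
            field_simp; ring
          have h2 : 0 ≤ ξ ^ 2 * y ^ 2 / (4 * σ) := by positivity
          linarith
        calc _ = (k ^ 2 * y ^ 3) * (Real.exp (2 * (-(y ^ 2 * (1 + ξ ^ 2)) / (2 * σ))) * Real.exp (2 * (y ^ 2 / (8 * σ)))) := by ring
          _ ≤ (k ^ 2 * y ^ 3) * Real.exp (-(3 / 4 * k) * y ^ 2) := by gcongr
          _ = _ := by ring
    _ = ENNReal.ofReal (k ^ 2 * (8 / 9 / k ^ 2)) := by
        rw [← hv2, ← integral_const_mul, ofReal_integral_eq_lintegral_ofReal (hi.const_mul _)]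
        filter_upwards [ae_restrict_mem measurableSet_Ioi] with y hy
        have hy0 : 0 < y := hy
        positivity
    _ ≤ 1 := by
        rw [ENNReal.ofReal_le_one]
        field_simp
        norm_num

lemma Iy_bd {ε t : ℝ} (hs : 0 < 1 + t / ε) (f : ℝ → ℂ) (u : ℝ → ENNReal) (hu : Measurable u)
    (h : ∀ᵐ y ∂(volume.restrict (Ioi (0:ℝ))), ‖f y‖ₑ = u y) {y : ℝ} (hy : 0 < y) :
    ‖Iy f y‖ₑ ≤ ENNReal.ofReal (√y) *
      L2N (volume.restrict (Ioi 0)) (fun y => u y * ENNReal.ofReal (rho ε t y)) := by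
  unfold Iy
  rw [intervalIntegral.integral_of_le hy.le]
  have h' : ∀ᵐ x ∂(volume.restrict (Ioc 0 y)), ‖f x‖ₑ = u x :=
    ae_mono (Measure.restrict_mono Ioc_subset_Ioi_self le_rfl) h
  calc ‖∫ x in Ioc 0 y, f x‖ₑ ≤ ∫⁻ x in Ioc 0 y, ‖f x‖ₑ := enorm_integral_le_lintegral_enorm _
    _ = ∫⁻ x in Ioc 0 y, 1 * u x := by
        rw [lintegral_congr_ae h']; simp
    _ ≤ L2N (volume.restrict (Ioc 0 y)) (fun _ => 1) * L2N (volume.restrict (Ioc 0 y)) u :=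
        holder2 _ (by fun_prop) (by fun_prop)
    _ ≤ _ := by
        gcongr
        · unfold L2N
          simp only [ENNReal.one_rpow, lintegral_const, one_mul, Measure.restrict_apply_univ,
            Real.volume_Ioc, sub_zero]
          rw [ENNReal.ofReal_rpow_of_nonneg hy.le (by norm_num), Real.sqrt_eq_rpow]
        · unfold L2N
          refine ENNReal.rpow_le_rpow ?_ (by norm_num)
          refine (lintegral_mono_set Ioc_subset_Ioi_self).trans ?_
          refine lintegral_mono fun x => ?_
          refine ENNReal.rpow_le_rpow ?_ (by norm_num)
          have : (1 : ENNReal) ≤ ENNReal.ofReal (rho ε t x) := by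
            rw [← ENNReal.ofReal_one]; exact ENNReal.ofReal_le_ofReal (one_le_rho hs x)
          calc u x = u x * 1 := (mul_one _).symm
            _ ≤ _ := mul_le_mul' le_rfl this

lemma main_bd {ε t τ r : ℝ} (hs : 0 < 1 + t / ε) (w : ℝ → ℝ → ℂ) (A : ℝ → ℂ)
    (u : ℝ × ℝ → ENNReal) (B V : ℝ → ENNReal) (hu : Measurable u) (hB : Measurable B)
    (hV : V = fun ξ => L2N (volume.restrict (Ioi 0))
      (fun y => u (ξ, y) * ENNReal.ofReal (rho ε t y)))
    (hVm : Measurable V)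
    (hw : ∀ᵐ p ∂((volume : Measure ℝ).prod ((volume : Measure ℝ).restrict (Ioi 0))),
      ‖w p.1 p.2‖ₑ = u p)
    (hA : ∀ᵐ x, ‖A x‖ₑ = B x) :
    ‖∫ ξ : ℝ, ∫ y in Ioi (0 : ℝ),
          Lcal ε t w A ξ y * (starRingEnd ℂ) (w ξ y) * ((wgt ε t τ r ξ y : ℝ) : ℂ)‖ₑ
    ≤ ∫⁻ z : ℝ × ℝ, ENNReal.ofReal (aWgt τ r z.1) * (B (z.1 - z.2) *
        (ENNReal.ofReal |z.1 - z.2| + 2 * ENNReal.ofReal |z.2|) * V z.2 * V z.1)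
        ∂(volume.prod volume) := by
  have hρ := rho_meas ε t
  have F1 := Measure.ae_ae_of_ae_prod hw
  have F2 : ∀ᵐ y ∂((volume : Measure ℝ).restrict (Ioi 0)), ∀ᵐ x : ℝ, ‖w x y‖ₑ = u (x, y) := by
    have := (Measure.measurePreserving_swap (μ := (volume : Measure ℝ).restrict (Ioi 0))
      (ν := (volume : Measure ℝ))).quasiMeasurePreserving.ae hw
    exact Measure.ae_ae_of_ae_prod this
  have hD : Measurable (fun p : ℝ × ℝ => dth ε t p.1 p.2) := by
    unfold dth; fun_prop
  have haW : Measurable (fun x => aWgt τ r x) := by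
    have := brak_cont.measurable
    unfold aWgt; fun_prop
  -- the pointwise integrand
  let P : ℝ → ℝ → ℝ → ENNReal := fun ξ y η =>
    B (ξ - η) * (ENNReal.ofReal |ξ - η| + ENNReal.ofReal |η|) * u (η, y) +
      B (ξ - η) * ENNReal.ofReal |η| * V η * ENNReal.ofReal (√y * dth ε t (ξ - η) y)
  have hL : ∀ ξ : ℝ, ∀ᵐ y ∂((volume : Measure ℝ).restrict (Ioi 0)),
      ‖Lcal ε t w A ξ y‖ₑ ≤ ∫⁻ η, P ξ y η := by
    intro ξ
    filter_upwards [F2, ae_restrict_mem measurableSet_Ioi] with y hy hy0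
    have hy0 : 0 < y := hy0
    have qs := quasiMeasurePreserving_sub_left (volume : Measure ℝ) ξ
    have hA' := qs.ae hA
    have hy' := qs.ae hy
    unfold Lcal
    rw [enorm_mul]
    have : ‖Complex.I‖ₑ = 1 := by rw [← ofReal_norm]; simp
    rw [this, one_mul]
    refine (enorm_integral_le_lintegral_enorm _).trans ?_
    calc _ ≤ ∫⁻ η, (u (η, y) * ENNReal.ofReal |ξ - η| * B (ξ - η)
            + B η * ENNReal.ofReal |ξ - η| * u (ξ - η, y)
            + ENNReal.ofReal |η| * V η * B (ξ - η) * ENNReal.ofReal (√y * dth ε t (ξ - η) y)) := by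
          refine lintegral_mono_ae ?_
          filter_upwards [hy, hy', hA, hA', F1] with η e1 e2 e3 e4 e5
          have er : ∀ x : ℝ, ‖(x : ℂ)‖ₑ = ENNReal.ofReal |x| := by
            intro x; rw [← ofReal_norm, Complex.norm_real, Real.norm_eq_abs]
          refine (enorm_sub_le).trans (add_le_add ((enorm_add_le _ _).trans (add_le_add ?_ ?_)) ?_)
          · rw [enorm_mul, enorm_mul, enorm_mul, e1, e4, er]
            calc _ ≤ u (η, y) * ENNReal.ofReal |ξ - η| * B (ξ - η) * 1 :=
                  mul_le_mul' le_rfl (theta_abs hs _ _)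
              _ = _ := by ring
          · rw [enorm_mul, enorm_mul, enorm_mul, e2, e3, er (ξ - η)]
            calc _ ≤ B η * 1 * ENNReal.ofReal |ξ - η| * u (ξ - η, y) := by
                  gcongr; exact theta_abs hs _ _
              _ = _ := by ring
          · have hI := Iy_bd hs (w η) (fun y => u (η, y)) (by fun_prop) e5 hy0
            have hVη : L2N (volume.restrict (Ioi 0))
              (fun y => u (η, y) * ENNReal.ofReal (rho ε t y)) = V η := by rw [hV]
            rw [hVη] at hI
            rw [enorm_mul, enorm_mul, enorm_mul, e4, er, er, deriv_theta hs]
            have hd : 0 ≤ dth ε t (ξ - η) y := by unfold dth; positivity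
            rw [abs_of_nonneg hd, ENNReal.ofReal_mul (Real.sqrt_nonneg y)]
            calc _ ≤ ENNReal.ofReal |η| * (ENNReal.ofReal √y * V η) * B (ξ - η) *
                  ENNReal.ofReal (dth ε t (ξ - η) y) := by gcongr
              _ = _ := by ring
      _ = (∫⁻ η, u (η, y) * ENNReal.ofReal |ξ - η| * B (ξ - η))
            + (∫⁻ η, B η * ENNReal.ofReal |ξ - η| * u (ξ - η, y))
            + ∫⁻ η, ENNReal.ofReal |η| * V η * B (ξ - η) * ENNReal.ofReal (√y * dth ε t (ξ - η) y) := by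
          rw [lintegral_add_left (by fun_prop), lintegral_add_left (by fun_prop)]
      _ = (∫⁻ η, u (η, y) * ENNReal.ofReal |ξ - η| * B (ξ - η))
            + (∫⁻ η, B (ξ - η) * ENNReal.ofReal |η| * u (η, y))
            + ∫⁻ η, ENNReal.ofReal |η| * V η * B (ξ - η) * ENNReal.ofReal (√y * dth ε t (ξ - η) y) := by
          congr 2
          rw [← lintegral_sub_left_eq_self (fun η => B η * ENNReal.ofReal |ξ - η| * u (ξ - η, y)) ξ]
          simp only [sub_sub_cancel]
      _ = _ := by
          rw [← lintegral_add_left (by fun_prop), ← lintegral_add_left (by fun_prop)]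
          refine lintegral_congr fun η => ?_
          simp only [P]; ring
  have hW : ∀ ξ y, ENNReal.ofReal (wgt ε t τ r ξ y) =
      ENNReal.ofReal (aWgt τ r ξ) * (ENNReal.ofReal (rho ε t y) * ENNReal.ofReal (rho ε t y)) := by
    intro ξ y
    have h1 : 0 ≤ rho ε t y := by unfold rho; positivity
    have h2 : 0 ≤ aWgt τ r ξ := by rw [← hw_sq]; positivity
    rw [← ENNReal.ofReal_mul h1, ← ENNReal.ofReal_mul h2]
    unfold wgt aWgt; congr 1; ring
  refine (enorm_integral_le_lintegral_enorm _).trans ?_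
  rw [lintegral_prod _ (by fun_prop)]
  refine lintegral_mono_ae ?_
  filter_upwards [F1] with ξ hξ
  refine (enorm_integral_le_lintegral_enorm _).trans ?_
  have hVξ : ∀ ξ, L2N (volume.restrict (Ioi 0))
    (fun y => u (ξ, y) * ENNReal.ofReal (rho ε t y)) = V ξ := by intro ξ; rw [hV]
  calc _ ≤ ∫⁻ y in Ioi (0:ℝ), ENNReal.ofReal (aWgt τ r ξ) * ∫⁻ η, P ξ y η *
          (u (ξ, y) * (ENNReal.ofReal (rho ε t y) * ENNReal.ofReal (rho ε t y))) := by
        refine lintegral_mono_ae ?_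
        filter_upwards [hξ, hL ξ] with y h1 h2
        rw [enorm_mul, enorm_mul, RCLike.enorm_conj, h1, ← ofReal_norm ((wgt ε t τ r ξ y : ℝ) : ℂ),
          Complex.norm_real, Real.norm_eq_abs, abs_of_nonneg (by
            unfold wgt; exact mul_nonneg (by positivity) (Real.rpow_nonneg (brak_pos _).le _)), hW,
          lintegral_mul_const _ (by simp only [P]; fun_prop)]
        calc _ ≤ (∫⁻ η, P ξ y η) * u (ξ, y) * (ENNReal.ofReal (aWgt τ r ξ) * (ENNReal.ofReal (rho ε t y) * ENNReal.ofReal (rho ε t y))) := by gcongr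
          _ = _ := by ring
    _ = ENNReal.ofReal (aWgt τ r ξ) * ∫⁻ η, ∫⁻ y in Ioi (0:ℝ), P ξ y η *
          (u (ξ, y) * (ENNReal.ofReal (rho ε t y) * ENNReal.ofReal (rho ε t y))) := by
        rw [lintegral_const_mul' _ _ ENNReal.ofReal_ne_top, lintegral_lintegral_swap]
        simp only [P, Function.uncurry_def]; fun_prop
    _ ≤ ENNReal.ofReal (aWgt τ r ξ) * ∫⁻ η, (B (ξ - η) *
        (ENNReal.ofReal |ξ - η| + 2 * ENNReal.ofReal |η|) * V η * V ξ) := by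
        gcongr with η
        calc _ = ∫⁻ y in Ioi (0:ℝ), (B (ξ - η) * (ENNReal.ofReal |ξ - η| + ENNReal.ofReal |η|) *
                  ((u (η, y) * ENNReal.ofReal (rho ε t y)) * (u (ξ, y) * ENNReal.ofReal (rho ε t y)))
                + B (ξ - η) * ENNReal.ofReal |η| * V η * ((ENNReal.ofReal (√y * dth ε t (ξ - η) y) * ENNReal.ofReal (rho ε t y)) * (u (ξ, y) * ENNReal.ofReal (rho ε t y)))) := by
              refine lintegral_congr fun y => ?_
              simp only [P]; ring
          _ = B (ξ - η) * (ENNReal.ofReal |ξ - η| + ENNReal.ofReal |η|) *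
                  (∫⁻ y in Ioi (0:ℝ), (u (η, y) * ENNReal.ofReal (rho ε t y)) * (u (ξ, y) * ENNReal.ofReal (rho ε t y)))
                + B (ξ - η) * ENNReal.ofReal |η| * V η * ∫⁻ y in Ioi (0:ℝ), ((ENNReal.ofReal (√y * dth ε t (ξ - η) y) * ENNReal.ofReal (rho ε t y)) * (u (ξ, y) * ENNReal.ofReal (rho ε t y))) := by
              rw [lintegral_add_left (by fun_prop), lintegral_const_mul _ (by fun_prop),
                lintegral_const_mul _ (by fun_prop)]
          _ ≤ B (ξ - η) * (ENNReal.ofReal |ξ - η| + ENNReal.ofReal |η|) * (V η * V ξ)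
              + B (ξ - η) * ENNReal.ofReal |η| * V η * (1 * V ξ) := by
              gcongr
              · refine (holder2 _ (by fun_prop) (by fun_prop)).trans ?_
                rw [hVξ, hVξ]
              · refine (holder2 _ (by fun_prop) (by fun_prop)).trans ?_
                rw [hVξ]
                exact mul_le_mul' (dth_L2 hs _) le_rfl
          _ = _ := by ring
    _ = _ := by rw [lintegral_const_mul _ (by fun_prop)]

lemma gk_nonneg (r x : ℝ) : 0 ≤ gk r x := Real.rpow_nonneg (brak_pos _).le _

lemma ofReal_abs_kernel {a z e c p q g1 g2 z' e' x : ℝ} (ha : 0 ≤ a) (hz : 0 ≤ z) (he : 0 ≤ e)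
    (hc : 0 ≤ c) (hp : 0 ≤ p) (hq : 0 ≤ q) (h1 : 0 ≤ g1) (h2 : 0 ≤ g2) (hz' : 0 ≤ z')
    (he' : 0 ≤ e') (hx : 0 ≤ x)
    (h : a * (z + 2 * e) ≤ c * (p * q) *
      (g1 + g2 + e' * x * g1 + e' * z' * g1 + z' * x * g2 + z' * e' * g2)) :
    ENNReal.ofReal a * (ENNReal.ofReal z + 2 * ENNReal.ofReal e) ≤
     ENNReal.ofReal c * (ENNReal.ofReal p * ENNReal.ofReal q) *
      (ENNReal.ofReal g1 + ENNReal.ofReal g2 + ENNReal.ofReal e' * ENNReal.ofReal x * ENNReal.ofReal g1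
      + ENNReal.ofReal e' * ENNReal.ofReal z' * ENNReal.ofReal g1
      + ENNReal.ofReal z' * ENNReal.ofReal x * ENNReal.ofReal g2
      + ENNReal.ofReal z' * ENNReal.ofReal e' * ENNReal.ofReal g2) := by
  have := ENNReal.ofReal_le_ofReal h
  simp (disch := positivity) only [ENNReal.ofReal_mul, ENNReal.ofReal_add, ENNReal.ofReal_ofNat] at this
  exact this

lemma tri_bd {τ r : ℝ} (hr : 2 < r) (hτ : 0 < τ) (B V : ℝ → ENNReal) (hB : Measurable B)
    (hV : Measurable V) (b v bh vh g : ℝ → ENNReal)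
    (hb : b = fun x => B x * ENNReal.ofReal (hw τ r x))
    (hv : v = fun x => V x * ENNReal.ofReal (hw τ r x))
    (hbh : bh = fun x => ENNReal.ofReal √|x| * (B x * ENNReal.ofReal (hw τ r x)))
    (hvh : vh = fun x => ENNReal.ofReal √|x| * (V x * ENNReal.ofReal (hw τ r x)))
    (hg : g = fun x => ENNReal.ofReal (gk r x)) :
    ∫⁻ z : ℝ × ℝ, ENNReal.ofReal (aWgt τ r z.1) * (B (z.1 - z.2) *
        (ENNReal.ofReal |z.1 - z.2| + 2 * ENNReal.ofReal |z.2|) * V z.2 * V z.1)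
        ∂(volume.prod volume) ≤
    ENNReal.ofReal (2 * 2 ^ r) * L2N volume g *
      (3 * (L2N volume vh * L2N volume v * L2N volume bh) +
        (2 * L2N volume v ^ 2 + L2N volume vh ^ 2) * L2N volume b) := by
  have mh := hw_meas τ r
  have mg := gk_meas r
  have Mb : Measurable b := by rw [hb]; fun_prop
  have Mv : Measurable v := by rw [hv]; fun_prop
  have Mbh : Measurable bh := by rw [hbh]; fun_prop
  have Mvh : Measurable vh := by rw [hvh]; fun_prop
  have Mg : Measurable g := by rw [hg]; fun_prop
  calc _ ≤ ∫⁻ z : ℝ × ℝ, ENNReal.ofReal (2 * 2 ^ r) *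
        (g (z.1 - z.2) * b (z.1 - z.2) * v z.2 * v z.1
        + (g z.2 * v z.2 * b (z.1 - z.2) * v z.1
        + (g (z.1 - z.2) * b (z.1 - z.2) * vh z.2 * vh z.1
        + (g (z.1 - z.2) * bh (z.1 - z.2) * vh z.2 * v z.1
        + (g z.2 * v z.2 * bh (z.1 - z.2) * vh z.1
        + g z.2 * vh z.2 * bh (z.1 - z.2) * v z.1))))) ∂(volume.prod volume) := by
        refine lintegral_mono fun z => ?_
        obtain ⟨ξ, η⟩ := z
        dsimp only
        have h := kernel_bd (r := r) (by linarith) hτ (ξ - η) η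
        rw [sub_add_cancel] at h
        have h' := ofReal_abs_kernel (hw_nonneg _ _ _) (abs_nonneg _) (abs_nonneg _) (by positivity)
          (hw_nonneg _ _ _) (hw_nonneg _ _ _)
          (gk_nonneg _ _) (gk_nonneg _ _)
          (Real.sqrt_nonneg _) (Real.sqrt_nonneg _) (Real.sqrt_nonneg _) h
        rw [← hw_sq, ENNReal.ofReal_pow (hw_nonneg _ _ _)]
        calc _ = (ENNReal.ofReal (hw τ r ξ) * (ENNReal.ofReal |ξ - η| + 2 * ENNReal.ofReal |η|)) *
              (ENNReal.ofReal (hw τ r ξ) * B (ξ - η) * V η * V ξ) := by ring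
          _ ≤ _ := mul_le_mul' h' le_rfl
          _ = _ := by
            rw [hb, hv, hbh, hvh, hg]; dsimp only; ring
    _ ≤ ENNReal.ofReal (2 * 2 ^ r) *
        (L2N volume g * L2N volume b * L2N volume v * L2N volume v
        + (L2N volume g * L2N volume v * L2N volume b * L2N volume v
        + (L2N volume g * L2N volume b * L2N volume vh * L2N volume vh
        + (L2N volume g * L2N volume bh * L2N volume vh * L2N volume v
        + (L2N volume g * L2N volume v * L2N volume bh * L2N volume vh
        + L2N volume g * L2N volume vh * L2N volume bh * L2N volume v))))) := by
        rw [lintegral_const_mul _ (by fun_prop)]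
        refine mul_le_mul' le_rfl ?_
        rw [lintegral_add_left (by fun_prop), lintegral_add_left (by fun_prop),
          lintegral_add_left (by fun_prop), lintegral_add_left (by fun_prop),
          lintegral_add_left (by fun_prop)]
        exact add_le_add (tri_zeta Mg Mb Mv Mv) (add_le_add (tri_eta Mg Mb Mv Mv)
          (add_le_add (tri_zeta Mg Mb Mvh Mvh) (add_le_add (tri_zeta Mg Mbh Mvh Mv)
          (add_le_add (tri_eta Mg Mbh Mv Mvh) (tri_eta Mg Mbh Mvh Mv)))))
    _ = _ := by ring

lemma ofReal_sqrt_eq (x : ℝ) : ENNReal.ofReal √x = ENNReal.ofReal x ^ (1 / 2 : ℝ) := by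
  rcases le_total 0 x with h | h
  · rw [ENNReal.ofReal_rpow_of_nonneg h (by norm_num), Real.sqrt_eq_rpow]
  · rw [Real.sqrt_eq_zero_of_nonpos h, ENNReal.ofReal_of_nonpos h]; simp

lemma ofReal_sqrt_sq {x : ℝ} : ENNReal.ofReal √x ^ (2:ℝ) = ENNReal.ofReal x := by
  rw [ofReal_sqrt_eq, ← ENNReal.rpow_mul]; norm_num

lemma L2N_sq {α : Type*} [MeasurableSpace α] (ν : Measure α) (f : α → ENNReal) :
    L2N ν f ^ (2:ℝ) = ∫⁻ x, f x ^ (2:ℝ) ∂ν := by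
  unfold L2N; rw [← ENNReal.rpow_mul]; norm_num

lemma ofReal_norm_sq (z : ℂ) : ENNReal.ofReal (‖z‖ ^ 2) = ‖z‖ₑ ^ (2:ℝ) := by
  rw [ENNReal.ofReal_pow (norm_nonneg _), ofReal_norm]; norm_cast

lemma hw_sq' (τ r x : ℝ) : ENNReal.ofReal (hw τ r x) ^ (2:ℝ) = ENNReal.ofReal (aWgt τ r x) := by
  rw [← hw_sq, ENNReal.ofReal_pow (hw_nonneg _ _ _)]; norm_cast

lemma aN {τ r : ℝ} (m : ℝ → ℝ) (hm : ∀ x, 0 ≤ m x) (A : ℝ → ℂ) (B : ℝ → ENNReal)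
    (hA : ∀ᵐ x, ‖A x‖ₑ = B x) (hf : aFinite τ r m A) :
    L2N volume (fun x => ENNReal.ofReal √(m x) * (B x * ENNReal.ofReal (hw τ r x)))
      = ENNReal.ofReal (aNorm τ r m A) := by
  unfold aNorm
  rw [ofReal_sqrt_eq]
  unfold L2N
  congr 1
  rw [ofReal_integral_eq_lintegral_ofReal hf]
  · refine lintegral_congr_ae ?_
    filter_upwards [hA] with x hx
    have := hm x
    rw [ENNReal.ofReal_mul (by positivity), ENNReal.ofReal_mul (hm x), ofReal_norm_sq, hx]
    simp only [ENNReal.mul_rpow_of_nonneg _ _ (zero_le_two : (0:ℝ) ≤ 2), hw_sq', ofReal_sqrt_sq]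
    ring
  · refine Eventually.of_forall fun x => ?_
    have := hm x
    have h2 : 0 ≤ aWgt τ r x := by rw [← hw_sq]; positivity
    show 0 ≤ m x * ‖A x‖ ^ 2 * aWgt τ r x
    positivity

lemma wN {ε t τ r : ℝ} (m : ℝ → ℝ) (hm : ∀ x, 0 ≤ m x) (w : ℝ → ℝ → ℂ) (u : ℝ × ℝ → ENNReal)
    (V : ℝ → ENNReal) (hu : Measurable u)
    (hV : V = fun ξ => L2N (volume.restrict (Ioi 0))
      (fun y => u (ξ, y) * ENNReal.ofReal (rho ε t y)))
    (hw' : ∀ᵐ p ∂((volume : Measure ℝ).prod ((volume : Measure ℝ).restrict (Ioi 0))),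
      ‖w p.1 p.2‖ₑ = u p) (hf : wFinite ε t τ r m w) :
    L2N volume (fun x => ENNReal.ofReal √(m x) * (V x * ENNReal.ofReal (hw τ r x)))
      = ENNReal.ofReal (wNorm ε t τ r m w) := by
  unfold wNorm
  rw [ofReal_sqrt_eq]
  unfold L2N
  congr 1
  have hρ := rho_meas ε t
  have hi := integral_prod _ hf
  dsimp only at hi
  rw [← hi, ofReal_integral_eq_lintegral_ofReal hf, lintegral_prod _ hf.aemeasurable.ennreal_ofReal]
  · refine lintegral_congr_ae ?_
    filter_upwards [Measure.ae_ae_of_ae_prod hw'] with x hx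
    have h1 : V x ^ (2:ℝ) = ∫⁻ y in Ioi 0, (u (x, y) * ENNReal.ofReal (rho ε t y)) ^ (2:ℝ) := by
      rw [hV, L2N_sq]
    simp only [ENNReal.mul_rpow_of_nonneg _ _ (zero_le_two : (0:ℝ) ≤ 2), hw_sq', ofReal_sqrt_sq] at h1 ⊢
    rw [h1, ← lintegral_mul_const _ (by fun_prop), ← lintegral_const_mul _ (by fun_prop)]
    refine lintegral_congr_ae ?_
    filter_upwards [hx] with y hy
    have := hm x
    have h1 : 0 ≤ rho ε t y := by unfold rho; positivity
    have h3 : wgt ε t τ r x y = rho ε t y ^ 2 * aWgt τ r x := by unfold wgt aWgt; ring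
    rw [ENNReal.ofReal_mul (by positivity), ENNReal.ofReal_mul (hm x), ofReal_norm_sq, hy, h3,
      ENNReal.ofReal_mul (by positivity), ENNReal.ofReal_pow h1]
    norm_cast
    ring
  · refine Eventually.of_forall fun x => ?_
    have := hm x.1
    have h2 : 0 ≤ wgt ε t τ r x.1 x.2 := by
      unfold wgt; exact mul_nonneg (by positivity) (Real.rpow_nonneg (brak_pos _).le _)
    show 0 ≤ m x.1 * ‖w x.1 x.2‖ ^ 2 * wgt ε t τ r x.1 x.2
    positivity

lemma meas_w {ε t τ r : ℝ} (w : ℝ → ℝ → ℂ) (hf : wFinite ε t τ r (fun _ => 1) w) :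
    AEMeasurable (fun p : ℝ × ℝ => ‖w p.1 p.2‖ₑ)
      ((volume : Measure ℝ).prod ((volume : Measure ℝ).restrict (Ioi 0))) := by
  have hρ := rho_meas ε t
  have hbm := brak_cont.measurable
  have hwm : Measurable (fun p : ℝ × ℝ => wgt ε t τ r p.1 p.2) := by
    unfold wgt; fun_prop
  have h := ((hf.aemeasurable.div hwm.aemeasurable).sqrt).ennreal_ofReal
  refine h.congr (Eventually.of_forall fun p => ?_)
  have h2 : 0 < wgt ε t τ r p.1 p.2 := by
    unfold wgt rho; exact mul_pos (by positivity) (Real.rpow_pos_of_pos (brak_pos _) _)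
  simp only [Pi.div_apply]
  rw [one_mul, mul_div_assoc, div_self h2.ne', mul_one, Real.sqrt_sq (norm_nonneg _), ofReal_norm]

lemma meas_A {τ r : ℝ} (A : ℝ → ℂ) (hf : aFinite τ r (fun _ => 1) A) :
    AEMeasurable (fun p : ℝ => ‖A p‖ₑ) volume := by
  have hbm := brak_cont.measurable
  have hwm : Measurable (fun p : ℝ => aWgt τ r p) := by
    unfold aWgt; fun_prop
  have h := ((hf.aemeasurable.div hwm.aemeasurable).sqrt).ennreal_ofReal
  refine h.congr (Eventually.of_forall fun p => ?_)
  have h2 : 0 < aWgt τ r p := by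
    unfold aWgt; exact mul_pos (by positivity) (Real.rpow_pos_of_pos (brak_pos _) _)
  simp only [Pi.div_apply]
  rw [one_mul, mul_div_assoc, div_self h2.ne', mul_one, Real.sqrt_sq (norm_nonneg _), ofReal_norm]


/-- **Bound (3.17b) of the paper** on `T_ℒ = ∫∫ ℒ_ξ conj(w̄_ξ) ρ² e^{2τ|ξ|}⟨ξ⟩^{2r} dy dξ`:
`|T_ℒ| ≤ C (‖|∂ₓ|^{1/2} w̄‖_{τ,r} ‖w̄‖_{τ,r} ‖|∂ₓ|^{1/2} A‖~_{τ,r}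
+ (‖w̄‖²_{τ,r} + ‖|∂ₓ|^{1/2} w̄‖²_{τ,r}) ‖A‖~_{τ,r})` with `C = C(r)`. -/
theorem TL_bound :
    ∀ r : ℝ, 2 < r →
    ∃ C : ℝ, 0 < C ∧
    ∀ (ε t τ : ℝ), 0 < ε → ε ≤ 1 → 0 ≤ t → t ≤ ε → 0 < τ →
    ∀ (w : ℝ → ℝ → ℂ) (A : ℝ → ℂ),
      (∀ ξ : ℝ, ContDiffOn ℝ 1 (w ξ) (Ici 0)) →
      (∀ ξ : ℝ, w ξ 0 = 0) →
      wFinite ε t τ r (fun ξ => |ξ|) w →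
      wFinite ε t τ r (fun _ => 1) w →
      aFinite τ r (fun ξ => |ξ|) A →
      aFinite τ r (fun _ => 1) A →
      Integrable (fun q : ℝ × ℝ × ℝ =>
        (w q.2.1 q.2.2 * ((q.1 - q.2.1 : ℝ) : ℂ) * A (q.1 - q.2.1) *
              ((theta ε t (q.1 - q.2.1) q.2.2 : ℝ) : ℂ)
            + A q.2.1 * ((theta ε t q.2.1 q.2.2 : ℝ) : ℂ) * ((q.1 - q.2.1 : ℝ) : ℂ) *
              w (q.1 - q.2.1) q.2.2
            - (q.2.1 : ℂ) * Iy (w q.2.1) q.2.2 * A (q.1 - q.2.1) *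
              ((deriv (theta ε t (q.1 - q.2.1)) q.2.2 : ℝ) : ℂ)) *
          (starRingEnd ℂ) (w q.1 q.2.2) * ((wgt ε t τ r q.1 q.2.2 : ℝ) : ℂ))
        ((volume : Measure ℝ).prod
          ((volume : Measure ℝ).prod ((volume : Measure ℝ).restrict (Ioi 0)))) →
      ‖∫ ξ : ℝ, ∫ y in Ioi (0 : ℝ),
          Lcal ε t w A ξ y * (starRingEnd ℂ) (w ξ y) * ((wgt ε t τ r ξ y : ℝ) : ℂ)‖
        ≤ C * (wNorm ε t τ r (fun ξ => |ξ|) w * wNorm ε t τ r (fun _ => 1) w *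
              aNorm τ r (fun ξ => |ξ|) A
            + ((wNorm ε t τ r (fun _ => 1) w) ^ 2
                + (wNorm ε t τ r (fun ξ => |ξ|) w) ^ 2) * aNorm τ r (fun _ => 1) A) := by
  intro r hr
  set G := L2N volume (fun x => ENNReal.ofReal (gk r x)) with hG
  have hGt : G ≠ ⊤ := gk_L2 hr
  refine ⟨3 * (2 * 2 ^ r * G.toReal) + 1, by positivity, ?_⟩
  intro ε t τ hε _ ht _ hτ w A _ _ hw1 hw0 hA1 hA0 _
  have hs : 0 < 1 + t / ε := by positivity
  have mw := meas_w w hw0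
  have mA := meas_A A hA0
  obtain ⟨u, hu, hwu⟩ := mw
  obtain ⟨B, hB, hAB⟩ := mA
  have hρ := rho_meas ε t
  obtain ⟨V, hV⟩ : ∃ V : ℝ → ENNReal, V = fun ξ => L2N (volume.restrict (Ioi 0))
      (fun y => u (ξ, y) * ENNReal.ofReal (rho ε t y)) := ⟨_, rfl⟩
  have hVm : Measurable V := by
    rw [hV]
    unfold L2N
    refine Measurable.pow_const ?_ _
    exact Measurable.lintegral_prod_right' (f := fun p : ℝ × ℝ => (u p * ENNReal.ofReal (rho ε t p.2)) ^ (2:ℝ)) (by fun_prop)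
  have h1 := main_bd (τ := τ) (r := r) hs w A u B V hu hB hV hVm hwu hAB
  have h2 := tri_bd hr hτ B V hB hVm _ _ _ _ _ rfl rfl rfl rfl rfl
  have e1 := wN (fun _ => 1) (fun _ => zero_le_one) w u V hu hV hwu hw0
  have e2 := wN (fun x => |x|) (fun x => abs_nonneg x) w u V hu hV hwu hw1
  have e3 := aN (fun _ => 1) (fun _ => zero_le_one) A B hAB hA0
  have e4 := aN (fun x => |x|) (fun x => abs_nonneg x) A B hAB hA1
  simp only [Real.sqrt_one, ENNReal.ofReal_one, one_mul] at e1 e3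
  rw [e1, e2, e3, e4, ← hG] at h2
  have h3 := h1.trans h2
  have n1 : 0 ≤ wNorm ε t τ r (fun _ => 1) w := Real.sqrt_nonneg _
  have n2 : 0 ≤ wNorm ε t τ r (fun x => |x|) w := Real.sqrt_nonneg _
  have n3 : 0 ≤ aNorm τ r (fun _ => 1) A := Real.sqrt_nonneg _
  have n4 : 0 ≤ aNorm τ r (fun x => |x|) A := Real.sqrt_nonneg _
  generalize wNorm ε t τ r (fun _ => 1) w = a1 at *
  generalize wNorm ε t τ r (fun x => |x|) w = a2 at *
  generalize aNorm τ r (fun _ => 1) A = a3 at *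
  generalize aNorm τ r (fun x => |x|) A = a4 at *
  rw [← ENNReal.ofReal_toReal hGt, ← ofReal_norm] at h3
  have hg0 : 0 ≤ G.toReal := ENNReal.toReal_nonneg
  generalize G.toReal = γ at *
  have h4 : ENNReal.ofReal (2 * 2 ^ r) * ENNReal.ofReal γ *
      (3 * (ENNReal.ofReal a2 * ENNReal.ofReal a1 * ENNReal.ofReal a4) +
        (2 * ENNReal.ofReal a1 ^ 2 + ENNReal.ofReal a2 ^ 2) * ENNReal.ofReal a3)
      = ENNReal.ofReal (2 * 2 ^ r * γ * (3 * (a2 * a1 * a4) + (2 * a1 ^ 2 + a2 ^ 2) * a3)) := by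
    simp (disch := positivity) only [ENNReal.ofReal_mul, ENNReal.ofReal_add, ENNReal.ofReal_ofNat,
      ENNReal.ofReal_pow]
  rw [h4, ENNReal.ofReal_le_ofReal_iff (by positivity)] at h3
  refine h3.trans ?_
  have k1 : 0 ≤ a2 * a1 * a4 := by positivity
  have k2 : 0 ≤ a1 ^ 2 * a3 := by positivity
  have k3 : 0 ≤ a2 ^ 2 * a3 := by positivity
  have k0 : 0 ≤ 2 * 2 ^ r * γ := by positivity
  generalize 2 * 2 ^ r * γ = c at *
  nlinarith [mul_nonneg k0 k1, mul_nonneg k0 k2, mul_nonneg k0 k3]
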